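/- Kirchhoff's lemma on incidence minors. Let G be a connected graph and let U ⊆ E be a subset of edges with |U| = n − 1. Then det(𝕀[U]) ∈ {−1, 0, +1}, and det(𝕀[U]) ≠ 0 if and only if U is a spanning tree of G. -/

import Mathlib

open Matrix BigOperators

namespace GraphForms

/-- Vertices `x` and `y` are connected using only edges in `T` (in either direction). -/
def Conn (m n : ℕ) (s t : Fin m → Fin n) (T : Set (Fin m)) (x y : Fin n) : Prop :=
  Relation.ReflTransGen
    (fun a b => ∃ e ∈ T, (s e = a ∧ t e = b) ∨ (s e = b ∧ t e = a)) x y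

/-- The graph is connected. -/
def IsConnectedGraph (m n : ℕ) (s t : Fin m → Fin n) : Prop :=
  ∀ x y, Conn m n s t Set.univ x y

/-- `T ⊆ E` is a spanning tree: it has `n - 1` edges and connects all vertices. -/
def IsSpanningTree (m n : ℕ) (s t : Fin m → Fin n) (T : Finset (Fin m)) : Prop :=
  T.card = n - 1 ∧ ∀ x y, Conn m n s t ↑T x y

/-- The reduced vertex incidence matrix `𝕀` (the distinguished vertex is the last one). -/
def inc (R : Type*) [Ring R] (m n' : ℕ) (s t : Fin m → Fin (n' + 1)) :
    Matrix (Fin m) (Fin n') R :=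
  Matrix.of fun e j =>
    (if t e = Fin.castSucc j then (1 : R) else 0) -
      (if s e = Fin.castSucc j then (1 : R) else 0)

/-- `C` is a cycle incidence matrix: its columns lie in, and form a `ℤ`-basis of,
the lattice `{x : ℤ^E | 𝕀ᵀ x = 0}`. -/
def IsCycleMatrix (m n' ℓ : ℕ) (s t : Fin m → Fin (n' + 1))
    (C : Matrix (Fin m) (Fin ℓ) ℤ) : Prop :=
  (inc ℤ m n' s t)ᵀ * C = 0 ∧
    ∀ x : Fin m → ℤ, (inc ℤ m n' s t)ᵀ.mulVec x = 0 →
      ∃! c : Fin ℓ → ℤ, C.mulVec c = x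

/-- The concatenation `[X|Y]` of the columns of `X` and of `Y`, a square matrix. -/
def concat {R : Type*} {m ℓ c : ℕ} (h : ℓ + c = m) (X : Matrix (Fin m) (Fin ℓ) R)
    (Y : Matrix (Fin m) (Fin c) R) : Matrix (Fin m) (Fin m) R :=
  Matrix.of fun i j => Sum.elim (X i) (Y i) (finSumFinEquiv.symm (Fin.cast h.symm j))

/-- The row submatrix `X[S]` (rows of `S` taken in increasing order);
junk value `0` if `S.card ≠ k`. -/
noncomputable def rowSub {R : Type*} [Zero R] {m c : ℕ} (X : Matrix (Fin m) (Fin c) R)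
    (S : Finset (Fin m)) (k : ℕ) : Matrix (Fin k) (Fin c) R :=
  if h : S.card = k then Matrix.of fun i j => X ((S.orderIsoOfFin h) i : Fin m) j else 0

/-- The expanded vertex Laplacian `𝕄`, rows/columns indexed by edges and then vertices. -/
def MM (m n' : ℕ) (s t : Fin m → Fin (n' + 1)) (a : Fin m → ℝ) :
    Matrix (Fin (m + n')) (Fin (m + n')) ℝ :=
  Matrix.of fun i j =>
    Matrix.fromBlocks (Matrix.diagonal a) (inc ℝ m n' s t) (-(inc ℝ m n' s t)ᵀ) 0
      (finSumFinEquiv.symm i) (finSumFinEquiv.symm j)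

/-- The Symanzik polynomial `ψ_G = det 𝕄`. -/
noncomputable def psi (m n' : ℕ) (s t : Fin m → Fin (n' + 1)) (a : Fin m → ℝ) : ℝ :=
  (MM m n' s t a).det

/-- The Dodgson polynomial `ψ^{A,B}`: delete the rows in `A` and the columns in `B`
from `𝕄` (keeping the induced order) and take the determinant. -/
noncomputable def dodgson (m n' : ℕ) (s t : Fin m → Fin (n' + 1)) (a : Fin m → ℝ)
    (A B : Finset (Fin (m + n'))) : ℝ :=
  if h : A.card = B.card then
    Matrix.det (Matrix.of fun i j : Fin (m + n' - A.card) =>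
      MM m n' s t a
        ((Aᶜ.orderIsoOfFin (by simp [Finset.card_compl]) i : Fin (m + n')))
        ((Bᶜ.orderIsoOfFin (by simp [Finset.card_compl, h]) j : Fin (m + n'))))
  else 0

/-- Index of the edge `i` among the rows/columns of `𝕄`. -/
def edgeIdx (m n' : ℕ) (i : Fin m) : Fin (m + n') := Fin.castAdd n' i

/-- Index of the vertex `j` among the rows/columns of `𝕄`. -/
def vtxIdx (m n' : ℕ) (j : Fin n') : Fin (m + n') := Fin.natAdd m j

/-- The edge Dodgson polynomial `ψ^{e_i,e_j}`. -/
noncomputable def dodgE (m n' : ℕ) (s t : Fin m → Fin (n' + 1)) (a : Fin m → ℝ)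
    (i j : Fin m) : ℝ :=
  dodgson m n' s t a {edgeIdx m n' i} {edgeIdx m n' j}

/-- The vertex Dodgson polynomial `ψ^{v_i,v_j}`. -/
noncomputable def dodgV (m n' : ℕ) (s t : Fin m → Fin (n' + 1)) (a : Fin m → ℝ)
    (i j : Fin n') : ℝ :=
  dodgson m n' s t a {vtxIdx m n' i} {vtxIdx m n' j}

/-- The vertex Laplacian `L = 𝕀ᵀ D⁻¹ 𝕀`. -/
noncomputable def vertexLap (m n' : ℕ) (s t : Fin m → Fin (n' + 1)) (a : Fin m → ℝ) :
    Matrix (Fin n') (Fin n') ℝ :=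
  (inc ℝ m n' s t)ᵀ * Matrix.diagonal (fun i => (a i)⁻¹) * inc ℝ m n' s t

/-- The cycle Laplacian `Λ = 𝒞ᵀ D 𝒞`. -/
def cycleLap {m ℓ : ℕ} (a : Fin m → ℝ) (C : Matrix (Fin m) (Fin ℓ) ℤ) :
    Matrix (Fin ℓ) (Fin ℓ) ℝ :=
  (C.map (Int.cast : ℤ → ℝ))ᵀ * Matrix.diagonal a * C.map (Int.cast : ℤ → ℝ)

/-- The degree-one generators `θ_i` of the exterior algebra `Ω`. -/
noncomputable def θ (m : ℕ) (i : Fin m) : ExteriorAlgebra ℝ (Fin m → ℝ) :=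
  ExteriorAlgebra.ι ℝ (Pi.single i 1)

/-- The Pfaffian of a `2k × 2k` matrix with entries in the exterior algebra. -/
noncomputable def pfaffian {m N k : ℕ} (hk : N = 2 * k)
    (X : Matrix (Fin N) (Fin N) (ExteriorAlgebra ℝ (Fin m → ℝ))) :
    ExteriorAlgebra ℝ (Fin m → ℝ) :=
  ((2 ^ k * (Nat.factorial k : ℝ))⁻¹) •
    ∑ σ : Equiv.Perm (Fin N), (((Equiv.Perm.sign σ : ℤ) : ℝ)) •
      (List.ofFn fun i : Fin k =>
        X (σ (Fin.cast hk.symm ⟨2 * i.1, by have := i.2; omega⟩))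
          (σ (Fin.cast hk.symm ⟨2 * i.1 + 1, by have := i.2; omega⟩))).prod

/-- `dΛ = 𝒞ᵀ Θ 𝒞`, with `Θ = diag(θ_1, ..., θ_m)`, in the exterior algebra. -/
noncomputable def dLam {m ℓ : ℕ} (C : Matrix (Fin m) (Fin ℓ) ℤ) :
    Matrix (Fin ℓ) (Fin ℓ) (ExteriorAlgebra ℝ (Fin m → ℝ)) :=
  (C.map fun z => algebraMap ℝ (ExteriorAlgebra ℝ (Fin m → ℝ)) (z : ℝ))ᵀ *
    Matrix.diagonal (θ m) *
    C.map fun z => algebraMap ℝ (ExteriorAlgebra ℝ (Fin m → ℝ)) (z : ℝ)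

/-- The Pfaffian form `φ_G = (−2π)^{−ℓ/2} Pf(dΛ Λ⁻¹ dΛ) / √ψ_G`. -/
noncomputable def phiForm (m n' ℓ k : ℕ) (hk : ℓ = 2 * k)
    (s t : Fin m → Fin (n' + 1)) (a : Fin m → ℝ) (C : Matrix (Fin m) (Fin ℓ) ℤ) :
    ExteriorAlgebra ℝ (Fin m → ℝ) :=
  ((((-2) * Real.pi) ^ k)⁻¹ * (Real.sqrt (psi m n' s t a))⁻¹) •
    pfaffian hk
      (dLam C * ((cycleLap a C)⁻¹).map (algebraMap ℝ (ExteriorAlgebra ℝ (Fin m → ℝ))) *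
        dLam C)

open Classical in
/-- Sum of `F T` over all spanning trees `T` of the graph. -/
noncomputable def treeSum {β : Type*} [AddCommMonoid β] (m n' : ℕ)
    (s t : Fin m → Fin (n' + 1)) (F : Finset (Fin m) → β) : β :=
  ∑ T ∈ Finset.univ.filter (fun T : Finset (Fin m) => IsSpanningTree m (n' + 1) s t T), F T

open Classical in
/-- The number of spanning trees of the graph. -/
noncomputable def treeCount (m n' : ℕ) (s t : Fin m → Fin (n' + 1)) : ℕ :=
  (Finset.univ.filter (fun T : Finset (Fin m) => IsSpanningTree m (n' + 1) s t T)).card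

/-- The summand of `α_G` corresponding to a spanning tree `T`. -/
noncomputable def alphaTerm {m n' ℓ k : ℕ} (hk : ℓ = 2 * k)
    (s t : Fin m → Fin (n' + 1)) (a : Fin m → ℝ) (T : Finset (Fin m)) :
    ExteriorAlgebra ℝ (Fin m → ℝ) :=
  if h : Tᶜ.card = ℓ then
    ((rowSub (inc ℝ m n' s t) T n').det *
        ∑ σ : Equiv.Perm (Fin ℓ), ∏ i : Fin k,
          dodgE m n' s t a
            ((Tᶜ.orderIsoOfFin h) (σ (Fin.cast hk.symm ⟨2 * i.1, by have := i.2; omega⟩)) : Fin m)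
            ((Tᶜ.orderIsoOfFin h) (σ (Fin.cast hk.symm ⟨2 * i.1 + 1, by have := i.2; omega⟩)) : Fin m)) •
      (List.ofFn fun j : Fin ℓ => θ m ((Tᶜ.orderIsoOfFin h) j : Fin m)).prod
  else 0

/-- The topological form `α_G`. -/
noncomputable def alphaForm (m n' ℓ k : ℕ) (hk : ℓ = 2 * k)
    (s t : Fin m → Fin (n' + 1)) (a : Fin m → ℝ) :
    ExteriorAlgebra ℝ (Fin m → ℝ) :=
  ((Real.pi ^ k * 4 ^ ℓ * (Nat.factorial k : ℝ) *
      psi m n' s t a ^ (((ℓ : ℝ) + 1) / 2))⁻¹) •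
    treeSum m n' s t (alphaTerm hk s t a)

/-- A walk in the graph, with signed edge traversals. -/
structure GWalk (m n : ℕ) (s t : Fin m → Fin n) (k : ℕ) where
  g : Fin k → Fin m
  ε : Fin k → ℤ
  u : Fin (k + 1) → Fin n
  hε : ∀ i, ε i = 1 ∨ ε i = -1
  hstep : ∀ i : Fin k,
    (ε i = 1 → s (g i) = u i.castSucc ∧ t (g i) = u i.succ) ∧
    (ε i = -1 → s (g i) = u i.succ ∧ t (g i) = u i.castSucc)

/-- The signed incidence vector of a walk. -/
def GWalk.vec {m n k : ℕ} {s t : Fin m → Fin n} (W : GWalk m n s t k) : Fin m → ℤ :=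
  fun e => ∑ i : Fin k, if W.g i = e then W.ε i else 0

/-- The lift of a vector along the subdivision of the edge `k` into two edges. -/
def liftVec {m : ℕ} (k : Fin m) (x : Fin m → ℤ) : Fin (m + 1) → ℤ :=
  fun i => if _ : i.1 ≤ k.1 then x ⟨i.1, by have := k.2; omega⟩
    else x ⟨i.1 - 1, by have := i.2; omega⟩


theorem rowSub_inc_mulVec_eq_zero_iff {R : Type*} [Ring R] {m n' : ℕ}
    (s t : Fin m → Fin (n' + 1)) {U : Finset (Fin m)} (hU : U.card = n') (v : Fin n' → R) :
    (rowSub (inc R m n' s t) U n') *ᵥ v = 0 ↔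
      ∀ e ∈ U, (Fin.snoc v 0 : Fin (n' + 1) → R) (t e) =
        (Fin.snoc v 0 : Fin (n' + 1) → R) (s e) := by
  have key : ∀ x : Fin (n' + 1), ∑ j : Fin n', (if x = j.castSucc then (1 : R) else 0) * v j =
      (Fin.snoc v 0 : Fin (n' + 1) → R) x := by
    intro x
    induction x using Fin.lastCases with
    | last => simp [(Fin.castSucc_ne_last _).symm]
    | cast i => simp
  have hrow : ∀ e, ∑ j, inc R m n' s t e j * v j =
      (Fin.snoc v 0 : Fin (n' + 1) → R) (t e) - (Fin.snoc v 0 : Fin (n' + 1) → R) (s e) := by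
    intro e
    simp only [inc, of_apply, sub_mul, Finset.sum_sub_distrib, key]
  have hentry : ∀ i, ((rowSub (inc R m n' s t) U n') *ᵥ v) i =
      ∑ j, inc R m n' s t (U.orderIsoOfFin hU i) j * v j := by
    intro i
    simp [rowSub, hU, mulVec, dotProduct]
  constructor
  · intro h e he
    have hi := congrFun h ((U.orderIsoOfFin hU).symm ⟨e, he⟩)
    rw [hentry, hrow] at hi
    simpa [sub_eq_zero] using hi
  · intro h
    ext i
    rw [hentry, hrow, h _ (U.orderIsoOfFin hU i).2, sub_self, Pi.zero_apply]

theorem Conn.apply_eq {α : Type*} {m n : ℕ} {s t : Fin m → Fin n} {T : Set (Fin m)}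
    {f : Fin n → α} (hf : ∀ e ∈ T, f (t e) = f (s e)) {x y : Fin n} (h : Conn m n s t T x y) :
    f x = f y := by
  induction h with
  | refl => rfl
  | tail _ hstep ih =>
    obtain ⟨e, he, ⟨rfl, rfl⟩ | ⟨rfl, rfl⟩⟩ := hstep
    · exact ih.trans (hf e he).symm
    · exact ih.trans (hf e he)

theorem Conn.symm {m n : ℕ} {s t : Fin m → Fin n} {T : Set (Fin m)} {x y : Fin n}
    (h : Conn m n s t T x y) : Conn m n s t T y x :=
  Relation.reflTransGen_swap.1 (Relation.ReflTransGen.mono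
    (fun _ _ ⟨e, he, h⟩ => ⟨e, he, h.symm⟩) _ _ h)

theorem det_rowSub_inc_ne_zero_iff (R : Type*) [CommRing R] [IsDomain R] {m n' : ℕ}
    (s t : Fin m → Fin (n' + 1)) {U : Finset (Fin m)} (hU : U.card = n') :
    (rowSub (inc R m n' s t) U n').det ≠ 0 ↔ ∀ x y, Conn m (n' + 1) s t U x y := by
  classical
  rw [Ne, ← exists_mulVec_eq_zero_iff]
  constructor
  · intro h
    have hlast : ∀ x, Conn m (n' + 1) s t U x (Fin.last n') := by
      by_contra! hx
      obtain ⟨x, hx⟩ := hx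
      let f : Fin (n' + 1) → R := fun y => if Conn m (n' + 1) s t U y (Fin.last n') then 0 else 1
      have hf : (Fin.snoc (fun j => f j.castSucc) 0 : Fin (n' + 1) → R) = f := by
        ext y
        induction y using Fin.lastCases with
        | last =>
          have : Conn m (n' + 1) s t U (Fin.last n') (Fin.last n') := .refl
          simp [f, this]
        | cast i => simp
      refine h ⟨fun j => f j.castSucc, fun h0 => ?_, ?_⟩
      · have h1 : f x = 0 := by
          rw [← hf, h0]
          induction x using Fin.lastCases <;> simp
        simp [f, hx] at h1
      · rw [rowSub_inc_mulVec_eq_zero_iff s t hU, hf]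
        intro e he
        have hst : Conn m (n' + 1) s t U (s e) (t e) := .single ⟨e, he, .inl ⟨rfl, rfl⟩⟩
        have : Conn m (n' + 1) s t U (t e) (Fin.last n') ↔
            Conn m (n' + 1) s t U (s e) (Fin.last n') :=
          ⟨hst.trans, hst.symm.trans⟩
        simp only [f, this]
    exact fun x y => (hlast x).trans (hlast y).symm
  · rintro h ⟨v, hv, hv0⟩
    rw [rowSub_inc_mulVec_eq_zero_iff s t hU] at hv0
    refine hv (funext fun j => ?_)
    simpa using (h j.castSucc (Fin.last n')).apply_eq hv0

theorem intCast_det_rowSub_inc (R : Type*) [CommRing R] {m n' : ℕ}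
    (s t : Fin m → Fin (n' + 1)) (U : Finset (Fin m)) :
    ((rowSub (inc ℤ m n' s t) U n').det : R) = (rowSub (inc R m n' s t) U n').det := by
  rw [Int.cast_det]
  congr 1
  ext i j
  by_cases hU : U.card = n' <;> simp [rowSub, hU, inc]

/-- **Kirchhoff's lemma on incidence minors.** -/
theorem kirchhoff_incidence_minor (m n' : ℕ) (s t : Fin m → Fin (n' + 1))
    (hconn : IsConnectedGraph m (n' + 1) s t)
    (U : Finset (Fin m)) (hU : U.card = n') :
    (rowSub (inc ℤ m n' s t) U n').det ∈ ({-1, 0, 1} : Set ℤ) ∧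
    ((rowSub (inc ℤ m n' s t) U n').det ≠ 0 ↔ IsSpanningTree m (n' + 1) s t U) := by
  have hiff := det_rowSub_inc_ne_zero_iff ℤ s t hU
  refine ⟨?_, hiff.trans ⟨fun h => ⟨by simpa using hU, h⟩, fun h => h.2⟩⟩
  by_cases h0 : (rowSub (inc ℤ m n' s t) U n').det = 0
  · simp [h0]
  · have h1 : (rowSub (inc ℤ m n' s t) U n').det.natAbs = 1 := by
      rw [Nat.eq_one_iff_not_exists_prime_dvd]
      intro p hp hdvd
      have := Fact.mk hp
      refine (det_rowSub_inc_ne_zero_iff (ZMod p) s t hU).2 (hiff.1 h0) ?_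
      rw [← intCast_det_rowSub_inc, ZMod.intCast_zmod_eq_zero_iff_dvd]
      exact Int.natCast_dvd.2 hdvd
    rcases Int.natAbs_eq_iff.1 h1 with h | h <;> simp [h]
end GraphForms
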